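/- Let K be an n×n real symmetric positive definite matrix with spectral decomposition K = ∑_{ℓ=1}^{n} λ_ℓ v_ℓ v_ℓᵀ, where {v_1,…,v_n} is an orthonormal basis of eigenvectors with eigenvalues λ_1,…,λ_n > 0, and let 1 ≤ k ≤ n. Then ∑_{C ⊆ {1,…,n}, |C| = k} (det(K_{CC})/e_k(λ)) · C K_{CC}^{-1} Cᵀ = ∑_{ℓ=1}^{n} v_ℓ v_ℓᵀ / (λ_ℓ + e_k(λ̂_ℓ)/e_{k−1}(λ̂_ℓ)), where λ = (λ_1,…,λ_n) and λ̂_ℓ ∈ ℝ^{n−1} is λ with the entry λ_ℓ removed. -/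

import Mathlib

open Matrix BigOperators Finset

/-- The `n × |C|` sampling matrix obtained by selecting the columns of the identity
matrix indexed by `C`. -/
def sampMatrix {n : ℕ} (C : Finset (Fin n)) : Matrix (Fin n) {x // x ∈ C} ℝ :=
  fun i j => if i = (j : Fin n) then 1 else 0

/-- The principal submatrix `K_{CC}` of `K` with rows and columns indexed by `C`. -/
def principalSub {n : ℕ} (K : Matrix (Fin n) (Fin n) ℝ) (C : Finset (Fin n)) :
    Matrix {x // x ∈ C} {x // x ∈ C} ℝ :=
  fun i j => K i j

/-- The elementary symmetric polynomial of degree `j` in the entries of `f` indexed by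
the subset `s` (with `e_0 = 1`).  Taking `s = univ.erase ℓ` gives `e_j` of the vector
with the `ℓ`-th entry removed. -/
def esymmOn {n : ℕ} (s : Finset (Fin n)) (j : ℕ) (f : Fin n → ℝ) : ℝ :=
  ∑ T ∈ s.powersetCard j, ∏ i ∈ T, f i

/-- The sum of the `k × k` principal minors of `M`. -/
def principalMinorSum {n : ℕ} (M : Matrix (Fin n) (Fin n) ℝ) (k : ℕ) : ℝ :=
  ∑ C ∈ univ.powersetCard k, (principalSub M C).det

/-- The unnormalized expectation of `C K_{CC}⁻¹ Cᵀ` under the `k`-determinantal weights. -/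
noncomputable def weightedInvSum {n : ℕ} (K : Matrix (Fin n) (Fin n) ℝ) (k : ℕ) :
    Matrix (Fin n) (Fin n) ℝ :=
  ∑ C ∈ univ.powersetCard k,
    (principalSub K C).det • (sampMatrix C * (principalSub K C)⁻¹ * (sampMatrix C)ᵀ)

lemma principalMinorSum_conj {n : ℕ} (V M : Matrix (Fin n) (Fin n) ℝ) (hV : Vᵀ * V = 1) (k : ℕ) :
    principalMinorSum (V * M * Vᵀ) k = principalMinorSum M k := by
  have key (A : Matrix (Fin n) (Fin n) ℝ) : principalMinorSum A k =
      (det (1 + (Polynomial.X : Polynomial ℝ) • A.map Polynomial.C)).coeff k :=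
    (coeff_det_one_add_X_smul_eq_sum_minors A k).symm
  have hV' : (Vᵀ).map Polynomial.C * V.map Polynomial.C = 1 := by
    rw [← Matrix.map_mul, hV, Matrix.map_one _ (map_zero _) (map_one _)]
  rw [key, key, Matrix.map_mul, Matrix.map_mul, Matrix.mul_assoc, ← Matrix.mul_smul,
    det_one_add_mul_comm]
  rw [← Matrix.mul_smul, Matrix.mul_assoc, Matrix.smul_mul, hV', Matrix.mul_smul,
    Matrix.mul_one]

lemma sampMatrix_transpose_mulVec {n : ℕ} (C : Finset (Fin n)) (x : Fin n → ℝ) :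
    (sampMatrix C)ᵀ *ᵥ x = fun i : {x // x ∈ C} => x i := by
  ext i
  simp [mulVec, dotProduct, sampMatrix]

lemma det_add_vecMulVec {m : Type*} [Fintype m] [DecidableEq m] (A : Matrix m m ℝ)
    (hA : IsUnit A.det) (x y : m → ℝ) :
    (A + vecMulVec x y).det = A.det * (1 + y ⬝ᵥ A⁻¹ *ᵥ x) := by
  rw [vecMulVec_eq Unit, det_add_replicateCol_mul_replicateRow hA, det_unique (n := Unit)]
  simp [Matrix.mul_apply, dotProduct, mulVec, Matrix.mul_assoc, Finset.mul_sum]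

lemma principalSub_posDef {n : ℕ} {K : Matrix (Fin n) (Fin n) ℝ} (hK : K.PosDef)
    (C : Finset (Fin n)) : (principalSub K C).PosDef :=
  hK.submatrix (e := ((↑) : {x // x ∈ C} → Fin n)) Subtype.val_injective

lemma dotProduct_weightedInvSum_mulVec {n : ℕ} {K : Matrix (Fin n) (Fin n) ℝ} (hK : K.PosDef)
    (k : ℕ) (x y : Fin n → ℝ) :
    y ⬝ᵥ weightedInvSum K k *ᵥ x =
      principalMinorSum (K + vecMulVec x y) k - principalMinorSum K k := by
  rw [weightedInvSum, principalMinorSum, principalMinorSum, ← sum_sub_distrib,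
    Matrix.sum_mulVec, dotProduct_sum]
  refine sum_congr rfl fun C _ => ?_
  have hadd : principalSub (K + vecMulVec x y) C = principalSub K C +
      vecMulVec ((sampMatrix C)ᵀ *ᵥ x) ((sampMatrix C)ᵀ *ᵥ y) := by
    simp only [sampMatrix_transpose_mulVec]
    rfl
  rw [hadd, det_add_vecMulVec _ (principalSub_posDef hK C).det_pos.ne'.isUnit, smul_mulVec,
    dotProduct_smul, ← mulVec_mulVec, ← mulVec_mulVec, dotProduct_mulVec y, ← mulVec_transpose,
    smul_eq_mul]
  ring

lemma weightedInvSum_conj {n : ℕ} {V D : Matrix (Fin n) (Fin n) ℝ} (hV : Vᵀ * V = 1)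
    (hD : D.PosDef) (hK : (V * D * Vᵀ).PosDef) (k : ℕ) :
    weightedInvSum (V * D * Vᵀ) k = V * weightedInvSum D k * Vᵀ := by
  have hform (x y : Fin n → ℝ) : y ⬝ᵥ (Vᵀ * weightedInvSum (V * D * Vᵀ) k * V) *ᵥ x =
      y ⬝ᵥ weightedInvSum D k *ᵥ x := by
    have hadd : V * D * Vᵀ + vecMulVec (V *ᵥ x) (V *ᵥ y) = V * (D + vecMulVec x y) * Vᵀ := by
      rw [Matrix.mul_add, Matrix.add_mul, mul_vecMulVec, vecMulVec_mul, vecMul_transpose]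
    rw [dotProduct_weightedInvSum_mulVec hD, ← mulVec_mulVec, ← mulVec_mulVec, dotProduct_mulVec y,
      vecMul_transpose, dotProduct_weightedInvSum_mulVec hK, hadd,
      principalMinorSum_conj V _ hV, principalMinorSum_conj V _ hV]
  have hmid : Vᵀ * weightedInvSum (V * D * Vᵀ) k * V = weightedInvSum D k := by
    ext i j
    simpa using hform (Pi.single j 1) (Pi.single i 1)
  have hV' : V * Vᵀ = 1 := mul_eq_one_comm.mp hV
  generalize weightedInvSum (V * D * Vᵀ) k = F at hmid ⊢
  rw [← hmid, Matrix.mul_assoc, Matrix.mul_assoc, hV', Matrix.mul_one,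
    ← Matrix.mul_assoc, hV', Matrix.one_mul]

lemma notMem_of_mem_powersetCard_erase {n : ℕ} {a : Fin n} {j : ℕ} {T : Finset (Fin n)}
    (hT : T ∈ (univ.erase a).powersetCard j) : a ∉ T :=
  fun h => notMem_erase a univ ((mem_powersetCard.mp hT).1 h)

lemma sum_powersetCard_univ_succ {n : ℕ} (a : Fin n) (k : ℕ) (g : Finset (Fin n) → ℝ) :
    ∑ C ∈ univ.powersetCard (k + 1), g C = ∑ C ∈ (univ.erase a).powersetCard (k + 1), g C +
      ∑ T ∈ (univ.erase a).powersetCard k, g (insert a T) := by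
  conv_lhs => rw [← insert_erase (mem_univ a), powersetCard_succ_insert (notMem_erase a univ)]
  rw [sum_union, sum_image]
  · intro S hS T hT h
    rw [← erase_insert (notMem_of_mem_powersetCard_erase hS), h, erase_insert (notMem_of_mem_powersetCard_erase hT)]
  · refine disjoint_left.mpr fun T hT hT' => notMem_of_mem_powersetCard_erase hT ?_
    obtain ⟨S, -, rfl⟩ := mem_image.mp hT'
    exact mem_insert_self a S

lemma esymmOn_univ_succ {n : ℕ} (a : Fin n) (k : ℕ) (f : Fin n → ℝ) :
    esymmOn univ (k + 1) f =
      esymmOn (univ.erase a) (k + 1) f + f a * esymmOn (univ.erase a) k f := by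
  rw [esymmOn, sum_powersetCard_univ_succ a, esymmOn, esymmOn, mul_sum]
  congr 1
  exact sum_congr rfl fun T hT => prod_insert (notMem_of_mem_powersetCard_erase hT)

lemma principalSub_diagonal {n : ℕ} (f : Fin n → ℝ) (C : Finset (Fin n)) :
    principalSub (diagonal f) C = diagonal fun i : {x // x ∈ C} => f i := by
  ext i j
  simp only [principalSub, diagonal_apply, Subtype.ext_iff]

lemma sampMatrix_diagonal_inv {n : ℕ} {f : Fin n → ℝ} (hf : ∀ i, f i ≠ 0) (C : Finset (Fin n)) :
    sampMatrix C * (principalSub (diagonal f) C)⁻¹ * (sampMatrix C)ᵀ =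
      diagonal fun a => if a ∈ C then (f a)⁻¹ else 0 := by
  have hinv : (principalSub (diagonal f) C)⁻¹ = diagonal fun i : {x // x ∈ C} => (f i)⁻¹ := by
    refine inv_eq_right_inv ?_
    rw [principalSub_diagonal, diagonal_mul_diagonal]
    simp [hf]
  rw [hinv]
  ext a b
  rw [Matrix.mul_apply]
  simp only [mul_diagonal, transpose_apply, sampMatrix]
  rw [sum_coe_sort C fun i => (if a = i then (1 : ℝ) else 0) * (f i)⁻¹ * if b = i then 1 else 0]
  by_cases hab : a = b
  · subst hab
    simp
  · simp [hab]

lemma weightedInvSum_diagonal {n : ℕ} {f : Fin n → ℝ} (hf : ∀ i, f i ≠ 0) (k : ℕ) :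
    weightedInvSum (diagonal f) (k + 1) =
      diagonal fun a => esymmOn (univ.erase a) k f := by
  have hterm (C : Finset (Fin n)) : (principalSub (diagonal f) C).det •
      (sampMatrix C * (principalSub (diagonal f) C)⁻¹ * (sampMatrix C)ᵀ) =
      diagonal fun a => if a ∈ C then (∏ i ∈ C, f i) * (f a)⁻¹ else 0 := by
    rw [sampMatrix_diagonal_inv hf, principalSub_diagonal, det_diagonal, prod_coe_sort C f,
      ← diagonal_smul]
    congr 1
    ext a
    simp
  rw [weightedInvSum, sum_congr rfl fun C _ => hterm C]
  ext a b
  rw [Matrix.sum_apply]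
  by_cases hab : a = b
  · subst hab
    simp only [diagonal_apply_eq]
    rw [sum_powersetCard_univ_succ a, sum_eq_zero, zero_add, esymmOn]
    · refine sum_congr rfl fun T hT => ?_
      rw [if_pos (mem_insert_self a T), prod_insert (notMem_of_mem_powersetCard_erase hT)]
      field_simp [hf a]
    · exact fun T hT => if_neg (notMem_of_mem_powersetCard_erase hT)
  · simp [diagonal_apply_ne _ hab]

lemma esymmOn_pos {n : ℕ} {s : Finset (Fin n)} {k : ℕ} {f : Fin n → ℝ} (hf : ∀ i, 0 < f i)
    (hk : k ≤ s.card) : 0 < esymmOn s k f :=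
  sum_pos (fun _ _ => prod_pos fun i _ => hf i) (powersetCard_nonempty.mpr hk)

lemma mul_diagonal_mul_transpose_eq_sum {n : ℕ} (v : Fin n → Fin n → ℝ) (f : Fin n → ℝ) :
    (of v)ᵀ * diagonal f * of v = ∑ ℓ, f ℓ • vecMulVec (v ℓ) (v ℓ) := by
  ext a b
  rw [Matrix.mul_apply, Matrix.sum_apply]
  refine sum_congr rfl fun ℓ _ => ?_
  simp only [mul_diagonal, transpose_apply, of_apply, Matrix.smul_apply, vecMulVec_apply,
    smul_eq_mul]
  ring

/-- Spectral expression for the kDPP expectation with implicit regularization: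
`E_{C ~ kDPP(K)}[C K_{CC}⁻¹ Cᵀ] = ∑ ℓ, v_ℓ v_ℓᵀ / (λ_ℓ + e_k(λ̂_ℓ)/e_{k−1}(λ̂_ℓ))`. -/
theorem kdpp_expectation_implicit_regularization (n : ℕ) (K : Matrix (Fin n) (Fin n) ℝ)
    (hsymm : K.IsSymm) (hPD : K.PosDef) (lam : Fin n → ℝ) (v : Fin n → Fin n → ℝ)
    (hpos : ∀ ℓ, 0 < lam ℓ)
    (hortho : ∀ i j, v i ⬝ᵥ v j = if i = j then (1 : ℝ) else 0)
    (hK : K = ∑ ℓ, lam ℓ • vecMulVec (v ℓ) (v ℓ))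
    (k : ℕ) (hk1 : 1 ≤ k) (hkn : k ≤ n) :
    ∑ C ∈ Finset.univ.powersetCard k,
        ((principalSub K C).det / esymmOn Finset.univ k lam) •
          (sampMatrix C * (principalSub K C)⁻¹ * (sampMatrix C)ᵀ) =
      ∑ ℓ, (lam ℓ + esymmOn (Finset.univ.erase ℓ) k lam /
              esymmOn (Finset.univ.erase ℓ) (k - 1) lam)⁻¹ •
        vecMulVec (v ℓ) (v ℓ) := by
  obtain ⟨m, rfl⟩ : ∃ m, k = m + 1 := ⟨k - 1, by lia⟩
  have hV : (of v)ᵀᵀ * (of v)ᵀ = 1 := by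
    ext i j
    rw [Matrix.mul_apply, one_apply, ← hortho i j]
    rfl
  have hKV : K = (of v)ᵀ * diagonal lam * (of v)ᵀᵀ := by
    rw [transpose_transpose, mul_diagonal_mul_transpose_eq_sum, hK]
  have hmain : weightedInvSum K (m + 1) =
      ∑ ℓ, esymmOn (univ.erase ℓ) m lam • vecMulVec (v ℓ) (v ℓ) := by
    rw [hKV, weightedInvSum_conj hV (PosDef.diagonal hpos) (hKV ▸ hPD),
      weightedInvSum_diagonal fun i => (hpos i).ne', transpose_transpose,
      mul_diagonal_mul_transpose_eq_sum]
  have hsmul : ∑ C ∈ univ.powersetCard (m + 1),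
        ((principalSub K C).det / esymmOn univ (m + 1) lam) •
          (sampMatrix C * (principalSub K C)⁻¹ * (sampMatrix C)ᵀ) =
      (esymmOn univ (m + 1) lam)⁻¹ • weightedInvSum K (m + 1) := by
    rw [weightedInvSum, smul_sum]
    exact sum_congr rfl fun C _ => by rw [smul_smul, div_eq_inv_mul]
  rw [hsmul, hmain, smul_sum]
  refine sum_congr rfl fun ℓ _ => ?_
  rw [smul_smul, Nat.add_sub_cancel]
  congr 1
  have he : 0 < esymmOn (univ.erase ℓ) m lam :=
    esymmOn_pos hpos (by rw [card_erase_of_mem (mem_univ ℓ), card_univ, Fintype.card_fin]; lia)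
  rw [esymmOn_univ_succ ℓ, add_div' _ _ _ he.ne', inv_div, inv_mul_eq_div, add_comm]
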